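/- Let n be a positive integer and let k be an integer with 2 ≤ k ≤ ⌊(n+1)/4⌋ + 2. Let S be a sequence in Z_n of length 2n − k that has no zero-sum subsequence of length n. Then there exist elements a, b ∈ Z_n with a − b generating Z_n, and integers u ≥ v with u + v ≥ 2n − 2k + 2, such that a occurs at least u times in S and b occurs at least v times in S; that is, S can be rearranged as (a^u, b^v, a_1', …, a_{2n−k−u−v}'). -/

import Mathlib

open Finset Pointwise

section Count

variable {α : Type*} [DecidableEq α]

theorem exists_count_max {R : Multiset α} (hR : R ≠ 0) :
    ∃ a ∈ R, ∀ c, R.count c ≤ R.count a := by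
  obtain ⟨a, ha, hmax⟩ := exists_max_image R.toFinset (fun c => R.count c)
    (by simpa [Finset.nonempty_iff_ne_empty] using hR)
  refine ⟨a, Multiset.mem_toFinset.1 ha, fun c => ?_⟩
  by_cases hc : c ∈ R
  · exact hmax c (Multiset.mem_toFinset.2 hc)
  · simp [Multiset.count_eq_zero_of_notMem hc]

/-- Among the elements outside a set `F` that does not exhaust `R`, one has maximal count. -/
theorem exists_count_max_notMem {R : Multiset α} (F : Finset α)
    (hF : ∑ a ∈ F, R.count a < R.card) :
    ∃ b ∈ R, b ∉ F ∧ ∀ c ∉ F, R.count c ≤ R.count b := by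
  have hne : R.filter (· ∉ F) ≠ 0 := by
    intro h0
    have h1 : ∀ x ∈ R, x ∈ F := by
      simpa [Multiset.filter_eq_nil] using h0
    rw [← Multiset.sum_count_eq_card h1] at hF
    exact lt_irrefl _ hF
  obtain ⟨b, hb, hmax⟩ := exists_count_max hne
  obtain ⟨hbR, hbF⟩ := Multiset.mem_filter.1 hb
  refine ⟨b, hbR, hbF, fun c hc => ?_⟩
  simpa [Multiset.count_filter, hc, hbF] using hmax c

/-- The counts over a finite set add up to at most the length. -/
theorem sum_count_le_card (R : Multiset α) (F : Finset α) : ∑ a ∈ F, R.count a ≤ R.card := by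
  have h1 : ∀ x ∈ R, x ∈ F ∪ R.toFinset := fun x hx => by simp [hx]
  rw [← Multiset.sum_count_eq_card h1]
  exact sum_le_sum_of_subset subset_union_left

end Count

section SubsetSums

variable {G : Type*} [AddCommGroup G]

/-- A sequence is zero-sum free if it has no nonempty zero-sum subsequence. -/
def ZeroSumFree (R : Multiset G) : Prop := ∀ U ≤ R, U.sum = 0 → U = 0

theorem ZeroSumFree.mono {R R' : Multiset G} (h : ZeroSumFree R) (hle : R' ≤ R) :
    ZeroSumFree R' := fun U hU => h U (hU.trans hle)

theorem ZeroSumFree.sum_ne_zero {R U : Multiset G} (h : ZeroSumFree R) (hU : U ≤ R)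
    (hne : U ≠ 0) : U.sum ≠ 0 := fun hs => hne (h U hU hs)

variable [DecidableEq G]

/-- **Scherk's theorem**: if `0` lies in `A` and `B` and is represented only trivially in `A + B`,
then `|A + B| ≥ |A| + |B| - 1`. -/
theorem scherk (B : Finset G) : ∀ A : Finset G, 0 ∈ A → 0 ∈ B →
    (∀ a ∈ A, ∀ b ∈ B, a + b = 0 → a = 0) → #A + #B ≤ #(A + B) + 1 := by
  induction B using Finset.strongInduction with
  | H B ih =>
  intro A hA hB hAB
  by_cases hstab : ∀ e ∈ A, ∀ b ∈ B, e + b ∈ A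
  · have hB0 : B = {0} := by
      refine eq_singleton_iff_unique_mem.2 ⟨hB, fun b hb => ?_⟩
      have hinj : Set.SurjOn (fun a => a + b) (A : Set G) A :=
        surjOn_of_injOn_of_card_le (fun a => a + b) (fun a ha => hstab a ha b hb)
          (fun x _ y _ hxy => add_right_cancel hxy) le_rfl
      obtain ⟨a, ha, hab⟩ := hinj hA
      have hab' : a + b = 0 := hab
      have h0 := hAB a ha b hb hab'
      rwa [h0, zero_add] at hab'
    subst hB0
    simp
  · push Not at hstab
    obtain ⟨e, he, b, hb, hne⟩ := hstab
    have hsub := addDysonETransform.subset e (A, B)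
    have hcard := addDysonETransform.card e (A, B)
    simp only [addDysonETransform_fst, addDysonETransform_snd] at hsub hcard
    have hlt : B ∩ (-e +ᵥ A) ⊂ B := by
      refine ⟨inter_subset_left, fun h => hne ?_⟩
      have := (mem_inter.1 (h hb)).2
      rw [mem_neg_vadd_finset_iff] at this
      simpa using this
    have h0 : (0 : G) ∈ B ∩ (-e +ᵥ A) := by
      simp [hB, mem_neg_vadd_finset_iff, he]
    have key := ih _ hlt (A ∪ (e +ᵥ B)) (mem_union_left _ hA) h0 ?_
    · have := card_le_card hsub
      omega
    · intro a ha b' hb' hab'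
      obtain ⟨hb'B, hb'A⟩ := mem_inter.1 hb'
      rw [mem_neg_vadd_finset_iff, vadd_eq_add] at hb'A
      rcases mem_union.1 ha with ha | ha
      · exact hAB a ha b' hb'B hab'
      · obtain ⟨c, hc, rfl⟩ := mem_vadd_finset.1 ha
        rw [vadd_eq_add] at hab' ⊢
        have h1 : e + b' = 0 := hAB _ hb'A c hc (by rw [← hab']; abel)
        have h2 : e = 0 := hAB e he b' hb'B h1
        have h3 : b' = 0 := by rwa [h2, zero_add] at h1
        rwa [h3, add_zero] at hab'

/-- A sequence of nonzero terms with multiplicities at most `h` that has no nonempty zero-sum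
subsequence of length at most `h` has more than `|Z|` sums of at most `h` terms. -/
theorem exists_sums_of_no_short_zero_sum (h : ℕ) : ∀ Z : Multiset G, (∀ z, Z.count z ≤ h) →
    0 ∉ Z → (∀ U ≤ Z, U.card ≤ h → U.sum = 0 → U = 0) →
    ∃ B : Finset G, 0 ∈ B ∧ Z.card + 1 ≤ #B ∧
      ∀ b ∈ B, ∃ U ≤ Z, U.card ≤ h ∧ U.sum = b := by
  induction h with
  | zero =>
    intro Z hZ _ _
    have : Z = 0 := Multiset.eq_zero_of_forall_notMem fun z hz => by
      have := Multiset.count_pos.2 hz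
      have := hZ z
      omega
    subst this
    exact ⟨{0}, by simp, by simp, fun b hb => ⟨0, le_rfl, by simp, by simp_all⟩⟩
  | succ h ih =>
    intro Z hZ h0 hfree
    have hle : Z.toFinset.val ≤ Z := by
      simpa using Multiset.dedup_le Z
    obtain ⟨B, hB0, hBc, hB⟩ := ih (Z - Z.toFinset.val) (fun z => by
        rw [Multiset.count_sub, Multiset.toFinset_val]
        have := hZ z
        by_cases hz : z ∈ Z
        · rw [Multiset.count_dedup, if_pos hz]; omega
        · rw [Multiset.count_eq_zero_of_notMem hz]; omega)
      (fun hz => h0 (Multiset.mem_of_le (Multiset.sub_le_self _ _) hz))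
      (fun U hU hc hs => hfree U (hU.trans (Multiset.sub_le_self _ _)) (by omega) hs)
    have hadd : ∀ U ≤ Z - Z.toFinset.val, ∀ a ∈ Z, a ::ₘ U ≤ Z := by
      intro U hU a ha
      have h1 : ({a} : Multiset G) ≤ Z.toFinset.val := by
        simpa using ha
      calc a ::ₘ U = {a} + U := by simp
        _ ≤ Z.toFinset.val + (Z - Z.toFinset.val) := add_le_add h1 hU
        _ = Z := add_tsub_cancel_of_le hle
    refine ⟨B + insert 0 Z.toFinset, ?_, ?_, ?_⟩
    · exact mem_add.2 ⟨0, hB0, 0, mem_insert_self _ _, add_zero 0⟩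
    · have := scherk (insert 0 Z.toFinset) B hB0 (mem_insert_self _ _) (by
        intro b hb a ha hab
        rcases mem_insert.1 ha with rfl | ha
        · simpa using hab
        · obtain ⟨U, hU, hUc, rfl⟩ := hB b hb
          have := hfree _ (hadd U hU a (Multiset.mem_toFinset.1 ha)) (by simp [hUc])
            (by rw [Multiset.sum_cons, add_comm, hab])
          simp at this)
      rw [card_insert_of_notMem (by simpa using h0)] at this
      rw [Multiset.card_sub hle] at hBc
      have hc := Multiset.card_le_card hle
      have : #Z.toFinset = Multiset.card Z.toFinset.val := rfl
      omega
    · intro x hx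
      obtain ⟨b, hb, a, ha, rfl⟩ := mem_add.1 hx
      obtain ⟨U, hU, hUc, rfl⟩ := hB b hb
      rcases mem_insert.1 ha with rfl | ha
      · exact ⟨U, hU.trans (Multiset.sub_le_self _ _), by omega, by simp⟩
      · exact ⟨a ::ₘ U, hadd U hU a (Multiset.mem_toFinset.1 ha), by simp [hUc],
          by rw [Multiset.sum_cons, add_comm]⟩

/-- A sequence of at least `|G|` nonzero terms with multiplicities at most `h` has a nonempty
zero-sum subsequence of length at most `h`. -/
theorem exists_short_zero_sum [Fintype G] (h : ℕ) (Z : Multiset G) (hZ : ∀ z, Z.count z ≤ h)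
    (h0 : 0 ∉ Z) (hcard : Fintype.card G ≤ Z.card) :
    ∃ U ≤ Z, U.card ≤ h ∧ U.sum = 0 ∧ U ≠ 0 := by
  by_contra! hcon
  obtain ⟨B, -, hB, -⟩ := exists_sums_of_no_short_zero_sum h Z hZ h0
    (fun U hU hc hs => hcon U hU hc hs)
  have := card_le_univ B
  omega

/-- The set of sums of all subsequences, the empty one included. -/
def subsetSums (R : Multiset G) : Finset G := (R.powerset.map Multiset.sum).toFinset

theorem mem_subsetSums {R : Multiset G} {x : G} : x ∈ subsetSums R ↔ ∃ U ≤ R, U.sum = x := by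
  simp [subsetSums]

theorem card_subsetSums_add {R R' : Multiset G} (h : ZeroSumFree (R + R')) :
    #(subsetSums R) + #(subsetSums R') ≤ #(subsetSums (R + R')) + 1 := by
  have hsub : subsetSums R + subsetSums R' ⊆ subsetSums (R + R') := by
    intro x hx
    obtain ⟨a, ha, b, hb, rfl⟩ := mem_add.1 hx
    obtain ⟨U, hU, rfl⟩ := mem_subsetSums.1 ha
    obtain ⟨V, hV, rfl⟩ := mem_subsetSums.1 hb
    exact mem_subsetSums.2 ⟨U + V, add_le_add hU hV, Multiset.sum_add _ _⟩
  have := scherk (subsetSums R') (subsetSums R) (mem_subsetSums.2 ⟨0, zero_le, rfl⟩)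
    (mem_subsetSums.2 ⟨0, zero_le, rfl⟩) (by
      intro a ha b hb hab
      obtain ⟨U, hU, rfl⟩ := mem_subsetSums.1 ha
      obtain ⟨V, hV, rfl⟩ := mem_subsetSums.1 hb
      have := h (U + V) (add_le_add hU hV) (by rw [Multiset.sum_add, hab])
      rw [(add_eq_zero.1 this).1, Multiset.sum_zero])
  have := card_le_card hsub
  omega

theorem card_subsetSums_ge {R : Multiset G} (h : ZeroSumFree R) :
    R.card + 1 ≤ #(subsetSums R) := by
  induction R using Multiset.induction with
  | empty => simp [subsetSums]
  | cons a R ih =>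
    have h1 := ih (h.mono (Multiset.le_cons_self _ _))
    have h2 := card_subsetSums_add (R := {a}) (R' := R) h
    have ha : a ≠ 0 := by
      simpa using h.sum_ne_zero (U := {a}) (by simp) (by simp)
    have h3 : ({0, a} : Finset G) ⊆ subsetSums {a} := by
      intro x hx
      rcases mem_insert.1 hx with rfl | hx
      · exact mem_subsetSums.2 ⟨0, zero_le, rfl⟩
      · rw [mem_singleton.1 hx]
        exact mem_subsetSums.2 ⟨{a}, le_rfl, by simp⟩
    have h4 := card_le_card h3
    rw [card_pair ha.symm] at h4
    rw [Multiset.singleton_add] at h2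
    rw [Multiset.card_cons]
    omega

theorem card_subsetSums_pair {a b : G} (hab : a ≠ b) (h : ZeroSumFree ({a, b} : Multiset G)) :
    4 ≤ #(subsetSums ({a, b} : Multiset G)) := by
  have ha : a ≠ 0 := by simpa using h.sum_ne_zero (U := {a}) (by simp) (by simp)
  have hb : b ≠ 0 := by simpa using h.sum_ne_zero (U := {b}) (by simp) (by simp)
  have hs : a + b ≠ 0 := by simpa using h.sum_ne_zero (U := {a, b}) le_rfl (by simp)
  have h3 : ({0, a, b, a + b} : Finset G) ⊆ subsetSums {a, b} := by
    intro x hx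
    rw [mem_subsetSums]
    simp only [mem_insert, mem_singleton] at hx
    rcases hx with rfl | rfl | rfl | rfl
    · exact ⟨0, zero_le, rfl⟩
    · exact ⟨{x}, by simp, by simp⟩
    · exact ⟨{x}, by simp, by simp⟩
    · exact ⟨{a, b}, le_rfl, by simp⟩
  refine le_trans ?_ (card_le_card h3)
  rw [card_insert_of_notMem, card_insert_of_notMem, card_pair]
  all_goals simp_all [eq_comm]

theorem card_subsetSums_triple {a b c : G} (hab : a ≠ b) (hac : a ≠ c) (hbc : b ≠ c)
    (h : ZeroSumFree ({a, b, c} : Multiset G)) :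
    6 ≤ #(subsetSums ({a, b, c} : Multiset G)) := by
  have hle : ∀ U : Multiset G, U ≤ {a, b, c} → U ≠ 0 → U.sum ≠ 0 := fun U => h.sum_ne_zero
  have lab : ({a, b} : Multiset G) ≤ {a, b, c} :=
    Multiset.cons_le_cons _ (by simp)
  have lac : ({a, c} : Multiset G) ≤ {a, b, c} :=
    Multiset.cons_le_cons _ (by simp)
  have lbc : ({b, c} : Multiset G) ≤ {a, b, c} := Multiset.le_cons_self _ _
  have ha : a ≠ 0 := by simpa using hle {a} (by simp) (by simp)
  have hb : b ≠ 0 := by simpa using hle {b} (by simp) (by simp)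
  have hc : c ≠ 0 := by simpa using hle {c} (by simp) (by simp)
  have sab : a + b ≠ 0 := by simpa using hle {a, b} lab (by simp)
  have sac : a + c ≠ 0 := by simpa using hle {a, c} lac (by simp)
  have sbc : b + c ≠ 0 := by simpa using hle {b, c} lbc (by simp)
  have sabc : a + (b + c) ≠ 0 := by simpa using hle {a, b, c} le_rfl (by simp)
  obtain ⟨d, hd, hda, hdb, hdc, hd0, hds⟩ : ∃ d ∈ subsetSums ({a, b, c} : Multiset G),
      d ≠ a ∧ d ≠ b ∧ d ≠ c ∧ d ≠ 0 ∧ d ≠ a + (b + c) := by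
    by_cases h1 : a + b = c
    · by_cases h2 : a + c = b
      · refine ⟨b + c, mem_subsetSums.2 ⟨{b, c}, lbc, by simp⟩, ?_, ?_, ?_, sbc, ?_⟩
        · intro h3
          apply sabc
          have h4 : c + c = 0 := by
            have : (a + c) + (b + c) = b + a := by rw [h2, h3]
            have h5 : (b + a) + (c + c) = (b + a) + 0 := by
              rw [add_zero]; exact Eq.trans (by abel) this
            exact add_left_cancel h5
          rw [← add_assoc, h1, h4]
        · simpa using hc
        · simpa using hb
        · simpa [eq_comm] using ha
      · exact ⟨a + c, mem_subsetSums.2 ⟨{a, c}, lac, by simp⟩, by simpa using hc, h2,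
          by simpa using ha, sac, fun h3 => hb (by
            have : a + c = a + c + b := h3.trans (by abel)
            simpa using this)⟩
    · exact ⟨a + b, mem_subsetSums.2 ⟨{a, b}, lab, by simp⟩, by simpa using hb,
        by simpa using ha, h1, sab, fun h3 => hc (by
            have : a + b = a + b + c := h3.trans (by abel)
            simpa using this)⟩
  have h3 : ({0, a, b, c, a + (b + c), d} : Finset G) ⊆ subsetSums {a, b, c} := by
    intro x hx
    simp only [mem_insert, mem_singleton] at hx
    rcases hx with rfl | rfl | rfl | rfl | rfl | rfl
    · exact mem_subsetSums.2 ⟨0, zero_le, rfl⟩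
    · exact mem_subsetSums.2 ⟨{x}, by simp, by simp⟩
    · exact mem_subsetSums.2 ⟨{x}, by simp, by simp⟩
    · exact mem_subsetSums.2 ⟨{x}, by simp, by simp⟩
    · exact mem_subsetSums.2 ⟨{a, b, c}, le_rfl, by simp⟩
    · exact hd
  refine le_trans ?_ (card_le_card h3)
  have e1 : b ≠ a + (b + c) := fun h => sac (by
    have : b + 0 = b + (a + c) := by rw [add_zero]; exact h.trans (by abel)
    exact (add_left_cancel this).symm)
  have e2 : c ≠ a + (b + c) := fun h => sab (by
    have : c + 0 = c + (a + b) := by rw [add_zero]; exact h.trans (by abel)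
    exact (add_left_cancel this).symm)
  rw [card_insert_of_notMem, card_insert_of_notMem, card_insert_of_notMem,
    card_insert_of_notMem, card_pair hds.symm]
  · simp [e2, hdc.symm]
  · simp [hbc, e1, hdb.symm]
  · simp [hab, hac, sbc, hda.symm]
  · simp [ha.symm, hb.symm, hc.symm, sabc.symm, hd0.symm]

/-- If `R` contains `t` disjoint pairs of distinct elements, each of them contributes an
additional subset sum. -/
theorem card_subsetSums_of_pairs (t : ℕ) : ∀ R : Multiset G, ZeroSumFree R → 2 * t ≤ R.card →
    (∀ c, R.count c + t ≤ R.card) → R.card + t + 1 ≤ #(subsetSums R) := by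
  induction t with
  | zero => exact fun R hR _ _ => card_subsetSums_ge hR
  | succ t ih =>
    intro R hR ht hcount
    obtain ⟨a, ha, -, hamax⟩ := exists_count_max_notMem (R := R) ∅ (by simp; omega)
    obtain ⟨b, hb, hba, hbmax⟩ := exists_count_max_notMem (R := R) {a} (by
      have := hcount a
      simp; omega)
    have hba' : b ≠ a := by simpa using hba
    have hle : ({a, b} : Multiset G) ≤ R := by
      rw [Multiset.le_iff_count]
      intro c
      have h1 := Multiset.count_pos.2 ha
      have h2 := Multiset.count_pos.2 hb
      simp only [Multiset.insert_eq_cons, Multiset.count_cons, Multiset.count_singleton]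
      split_ifs <;> simp_all <;> omega
    obtain ⟨R', rfl⟩ := Multiset.le_iff_exists_add.1 hle
    have h1 := card_subsetSums_add hR
    have h2 := card_subsetSums_pair hba'.symm (hR.mono (Multiset.le_add_right _ _))
    have h3 := ih R' (hR.mono (Multiset.le_add_left _ _)) (by simp at ht; omega) (by
      intro c
      by_cases hc : c = a ∨ c = b
      · have := hcount c
        rcases hc with rfl | rfl <;>
        simp [hba', hba'.symm] at this <;> omega
      · push Not at hc
        have e1 := hbmax c (by simpa using hc.1)
        have e2 := hamax b (by simp)
        have e3 := sum_count_le_card ({a, b} + R') {a, b, c}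
        rw [sum_insert (by simp [hba'.symm, hc.1.symm]), sum_insert (by simp [hc.2.symm]),
          sum_singleton] at e3
        have e4 : ({a, b} + R' : Multiset G).count c = R'.count c := by
          simp [hc.1, hc.2]
        have e5 : ({a, b} + R' : Multiset G).card = R'.card + 2 := by simp
        omega)
    have e5 : ({a, b} + R' : Multiset G).card = R'.card + 2 := by simp
    omega

/-- A zero-sum free sequence of odd length `2s + 1` in which no element has multiplicity
exceeding `s` has at least `3s + 3` subset sums. -/
theorem card_subsetSums_of_odd {R : Multiset G} (hR : ZeroSumFree R) {s : ℕ}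
    (hs : R.card = 2 * s + 1) (hcount : ∀ c, R.count c ≤ s) : 3 * s + 3 ≤ #(subsetSums R) := by
  obtain ⟨a, ha, -, hamax⟩ := exists_count_max_notMem (R := R) ∅ (by simp; omega)
  obtain ⟨b, hb, hba, hbmax⟩ := exists_count_max_notMem (R := R) {a} (by
    have := hcount a
    simp; omega)
  have hba' : b ≠ a := by simpa using hba
  obtain ⟨c, hc, hcab, hcmax⟩ := exists_count_max_notMem (R := R) {a, b} (by
    have := hcount a
    have := hcount b
    rw [sum_pair hba'.symm]; omega)
  have hca : c ≠ a := fun h => hcab (by simp [h])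
  have hcb : c ≠ b := fun h => hcab (by simp [h])
  have hle : ({a, b, c} : Multiset G) ≤ R := by
    rw [Multiset.le_iff_count]
    intro d
    have h1 := Multiset.count_pos.2 ha
    have h2 := Multiset.count_pos.2 hb
    have h3 := Multiset.count_pos.2 hc
    simp only [Multiset.insert_eq_cons, Multiset.count_cons, Multiset.count_singleton]
    split_ifs <;> simp_all <;> omega
  obtain ⟨R', rfl⟩ := Multiset.le_iff_exists_add.1 hle
  have h1 := card_subsetSums_add hR
  have h2 := card_subsetSums_triple hba'.symm hca.symm hcb.symm
    (hR.mono (Multiset.le_add_right _ _))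
  have e5 : ({a, b, c} + R' : Multiset G).card = R'.card + 3 := by simp
  have h3 := card_subsetSums_of_pairs (s - 1) R' (hR.mono (Multiset.le_add_left _ _))
    (by omega) (by
    intro d
    by_cases hd : d = a ∨ d = b ∨ d = c
    · have := hcount d
      rcases hd with rfl | rfl | rfl <;>
      simp [hba', hba'.symm, hca, hca.symm,
        hcb, hcb.symm] at this <;> omega
    · push Not at hd
      have e0 := hcmax d (by simp [hd.1, hd.2.1])
      have e1 := hbmax c (by simpa using hca)
      have e2 := hamax b (by simp)
      have e3 := sum_count_le_card ({a, b, c} + R') {a, b, c, d}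
      rw [sum_insert (by simp [hba'.symm, hca.symm, hd.1.symm]),
        sum_insert (by simp [hcb.symm, hd.2.1.symm]), sum_pair hd.2.2.symm] at e3
      have e4 : ({a, b, c} + R' : Multiset G).count d = R'.count d := by
        simp [hd.1, hd.2.1, hd.2.2]
      omega)
  omega

end SubsetSums

section NatSums

variable {α : Type*} (f : α → ℕ)

/-- If the weights of `N` sum to at least `c`, some partial sum crosses `c`. -/
theorem exists_crossing {c : ℕ} (hc : 0 < c) (N : Multiset α) (h : c ≤ (N.map f).sum) :
    ∃ (Q : Multiset α) (w : α), w ::ₘ Q ≤ N ∧ (Q.map f).sum < c ∧ c ≤ f w + (Q.map f).sum := by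
  induction N using Multiset.induction with
  | empty => simp at h; omega
  | cons a N ih =>
    by_cases h' : c ≤ (N.map f).sum
    · obtain ⟨Q, w, hle, h1, h2⟩ := ih h'
      exact ⟨Q, w, hle.trans (Multiset.le_cons_self _ _), h1, h2⟩
    · exact ⟨N, a, le_rfl, by omega, by simpa using h⟩

theorem card_le_sum_map {R : Multiset α} (hR : ∀ r ∈ R, 1 ≤ f r) : R.card ≤ (R.map f).sum := by
  simpa using Multiset.sum_map_le_sum_map (fun _ => 1) f hR

/-- Positive weights with small sum: at least `2|R| - ∑ f` of them are equal to `1`. -/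
theorem two_mul_card_le {R : Multiset α} (hR : ∀ r ∈ R, 1 ≤ f r) :
    2 * R.card ≤ (R.map f).sum + R.countP (fun r => f r = 1) := by
  induction R using Multiset.induction with
  | empty => simp
  | cons a R ih =>
    have h1 := ih fun r hr => hR r (Multiset.mem_cons_of_mem hr)
    have h2 := hR a (Multiset.mem_cons_self _ _)
    simp only [Multiset.card_cons, Multiset.map_cons, Multiset.sum_cons, Multiset.countP_cons]
    split_ifs <;> omega

/-- Positive weights with sum less than `2|R|` realize every number up to their sum as the sum of
a subfamily, which can moreover be taken long. -/
theorem exists_le_sum_map_eq (R : Multiset α) : (∀ r ∈ R, 1 ≤ f r) →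
    (R.map f).sum < 2 * R.card → ∀ Y ≤ (R.map f).sum,
    ∃ U ≤ R, (U.map f).sum = Y ∧ min Y (2 * R.card - (R.map f).sum) ≤ U.card := by
  induction R using Multiset.strongInductionOn with
  | ih R ih =>
  intro hR hlt Y hY
  by_cases hone : ∀ r ∈ R, f r = 1
  · have hmap : ∀ U ≤ R, (U.map f).sum = U.card := fun U hU => by
      rw [Multiset.map_congr rfl fun r hr => hone r (Multiset.mem_of_le hU hr)]
      simp
    rw [hmap R le_rfl] at hY
    obtain ⟨U, hU'⟩ := Multiset.exists_mem_of_ne_zero (s := Multiset.powersetCard Y R) (by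
      rw [← Multiset.card_pos, Multiset.card_powersetCard]
      exact Nat.choose_pos hY)
    obtain ⟨hU, hc⟩ := Multiset.mem_powersetCard.1 hU'
    exact ⟨U, hU, by rw [hmap U hU, hc], by omega⟩
  · push Not at hone
    obtain ⟨x, hx, hx1⟩ := hone
    obtain ⟨R', rfl⟩ := Multiset.exists_cons_of_mem hx
    have hx2 := hR x hx
    have hR' : ∀ r ∈ R', 1 ≤ f r := fun r hr => hR r (Multiset.mem_cons_of_mem hr)
    have hcard := card_le_sum_map f hR'
    simp only [Multiset.card_cons, Multiset.map_cons, Multiset.sum_cons] at hlt hY ⊢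
    have ih' := ih R' (Multiset.lt_cons_self _ _) hR' (by omega)
    by_cases hY' : Y ≤ (R'.map f).sum
    · obtain ⟨U, hU, hs, hc⟩ := ih' Y hY'
      exact ⟨U, hU.trans (Multiset.le_cons_self _ _), hs, by omega⟩
    · obtain ⟨U, hU, hs, hc⟩ := ih' (Y - f x) (by omega)
      refine ⟨x ::ₘ U, Multiset.cons_le_cons _ hU, ?_, ?_⟩
      · rw [Multiset.map_cons, Multiset.sum_cons, hs]
        omega
      · rw [Multiset.card_cons]
        omega

end NatSums

section CyclicZeroSumFree

theorem ZeroSumFree.map {G H : Type*} [AddCommGroup G] [AddCommGroup H] {R : Multiset G}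
    (hR : ZeroSumFree R) (e : G ≃+ H) : ZeroSumFree (R.map e) := by
  intro U hU hs
  have h1 : U.map e.symm ≤ R := by
    simpa [Multiset.map_map] using Multiset.map_le_map (f := e.symm) hU
  have h2 := hR _ h1 (by rw [← map_multiset_sum, hs, map_zero])
  simpa using h2

theorem ZeroSumFree.zero_notMem {G : Type*} [AddCommGroup G] {R : Multiset G}
    (hR : ZeroSumFree R) : 0 ∉ R := fun h =>
  hR.sum_ne_zero (U := {0}) (by simpa using h) (by simp) (by simp)

variable {n : ℕ}

theorem ZMod.natCast_sum_map_val [NeZero n] (U : Multiset (ZMod n)) :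
    (((U.map ZMod.val).sum : ℕ) : ZMod n) = U.sum := by
  rw [Nat.cast_multiset_sum, Multiset.map_map]
  simp

theorem ZMod.one_le_val [NeZero n] {a : ZMod n} (ha : a ≠ 0) : 1 ≤ a.val := by
  have := (ZMod.val_ne_zero a).2 ha
  omega

/-- A zero-sum free sequence in `ZMod n` in which `1` is sufficiently frequent has the sum of its
least positive representatives less than `n`. -/
theorem ZeroSumFree.sum_val_lt_of_count_one (hn : 1 < n) {R : Multiset (ZMod n)}
    (hR : ZeroSumFree R) (hv : 2 * R.card + 1 ≤ R.count 1 + n) (hK : 3 * n ≤ 4 * R.card + 5)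
    (hex : ¬(n = 7 ∧ R.card = 4)) : (R.map ZMod.val).sum < n := by
  have : NeZero n := ⟨by omega⟩
  have : Fact (1 < n) := ⟨hn⟩
  by_contra! hsum
  set v := R.count 1 with hvdef
  set X := R.filter (fun r => ¬ 1 = r) with hX
  have hRX : R = X + Multiset.replicate v 1 := by
    rw [hvdef, ← Multiset.filter_eq, add_comm]
    exact (Multiset.filter_add_not _ _).symm
  have hcard : R.card = X.card + v := by
    conv_lhs => rw [hRX]
    simp
  have hsumX : (R.map ZMod.val).sum = (X.map ZMod.val).sum + v := by
    conv_lhs => rw [hRX]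
    simp [ZMod.val_one]
  have hz : ∀ U ≤ X, ∀ j ≤ v, n ∣ (U.map ZMod.val).sum + j → U = 0 ∧ j = 0 := by
    intro U hU j hj hdvd
    have h1 : U + Multiset.replicate j 1 ≤ R := by
      conv_rhs => rw [hRX]
      exact add_le_add hU (Multiset.replicate_le_replicate _ |>.2 hj)
    have h2 := hR _ h1 (by
      rw [← ZMod.natCast_sum_map_val, ZMod.natCast_eq_zero_iff]
      simpa [ZMod.val_one] using hdvd)
    obtain ⟨h3, h4⟩ := add_eq_zero.1 h2
    exact ⟨h3, by simpa using congrArg Multiset.card h4⟩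
  have hz' : ∀ U ≤ X, (U.map ZMod.val).sum ≤ n → n ≤ (U.map ZMod.val).sum + v → False := by
    intro U hU h1 h2
    obtain ⟨h3, h4⟩ := hz U hU (n - (U.map ZMod.val).sum) (by omega)
      ⟨1, by omega⟩
    subst h3
    simp at h4
    omega
  have hX2 : ∀ x ∈ X, 2 ≤ x.val := by
    intro x hx
    obtain ⟨hxR, hx1⟩ := Multiset.mem_filter.1 hx
    have h0 : x ≠ 0 := fun h => hR.zero_notMem (h ▸ hxR)
    have h1 := ZMod.one_le_val h0
    have h2 : x.val ≠ 1 := fun h => hx1 (ZMod.val_injective n (by rw [h, ZMod.val_one]))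
    omega
  have hXv : ∀ x ∈ X, x.val + v < n := by
    intro x hx
    by_contra! h
    have := ZMod.val_lt x
    exact hz' {x} (by simpa using hx) (by simp; omega) (by simpa using h)
  have hvn : v < n := by
    by_contra! h
    exact hz' 0 zero_le (by simp) (by simpa using h)
  obtain ⟨Q, w, hQ, h1, h2⟩ := exists_crossing ZMod.val (c := n - v) (by omega) X (by omega)
  have hw := hXv w (Multiset.mem_of_le hQ (Multiset.mem_cons_self _ _))
  have h3 : n < w.val + (Q.map ZMod.val).sum := by
    by_contra! h
    exact hz' _ hQ (by simpa using h) (by simp; omega)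
  have hnv : n = 2 * v + 3 := by omega
  have hwv : w.val = v + 2 := by omega
  induction Q using Multiset.induction with
  | empty => simp at h3; omega
  | cons q Q _ =>
    have hq2 := hX2 q (Multiset.mem_of_le hQ (by simp))
    have hwq : ({w, q} : Multiset (ZMod n)) ≤ X :=
      le_trans (Multiset.cons_le_cons _ (by simp)) hQ
    simp only [Multiset.map_cons, Multiset.sum_cons] at h1 h2 h3
    have hqw : q = w := by
      induction Q using Multiset.induction with
      | empty =>
        simp at h3
        exact ZMod.val_injective n (by omega)
      | cons q' Q _ =>
        have hq2' := hX2 q' (Multiset.mem_of_le hQ (by simp))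
        simp only [Multiset.map_cons, Multiset.sum_cons] at h1
        exact (hz' _ hwq (by simp; omega) (by simp; omega)).elim
    subst hqw
    obtain ⟨Y, hY⟩ := Multiset.le_iff_exists_add.1 hwq
    have hYc : X.card = 2 + Y.card := by rw [hY]; simp; omega
    have hYne : Y ≠ 0 := by
      rintro rfl
      simp at hYc
      exact hex ⟨by omega, by omega⟩
    obtain ⟨r, hr⟩ := Multiset.exists_mem_of_ne_zero hYne
    have hrle : ({q, q} + {r} : Multiset (ZMod n)) ≤ X := by
      rw [hY]
      exact add_le_add le_rfl (by simpa using hr)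
    have hrX : r ∈ X := Multiset.mem_of_le hrle (by simp)
    have hr2 := hX2 r hrX
    have hrv := hXv r hrX
    by_cases hrv' : r.val = v + 2
    · have := (hz _ hrle v le_rfl ⟨2, by simp; omega⟩).1
      simp at this
    · refine hz' {q, r} (le_trans ?_ hrle) (by simp; omega) (by simp; omega)
      have hqq : ({q} : Multiset (ZMod n)) ≤ {q, q} :=
        Multiset.singleton_le.2 (Multiset.mem_cons_self _ _)
      exact add_le_add hqq (le_refl {r})

end CyclicZeroSumFree

section Structure

variable {n : ℕ}

/-- In a cyclic group of order `n`, a long zero-sum free sequence has a term of large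
multiplicity. -/
theorem ZeroSumFree.count_max_ge [NeZero n] {R : Multiset (ZMod n)} (hR : ZeroSumFree R)
    (hK : 3 * n ≤ 4 * R.card + 5) (hex : ¬(n = 7 ∧ R.card = 4)) (hne : R ≠ 0) {a : ZMod n}
    (ha : ∀ c, R.count c ≤ R.count a) (ha1 : 1 ≤ R.count a) :
    2 * R.card + 1 ≤ R.count a + n := by
  by_contra! hlt
  have hpos : 1 ≤ R.card := Multiset.card_pos.2 hne
  have hle : #(subsetSums R) ≤ n := by
    simpa [ZMod.card] using Finset.card_le_univ (subsetSums R)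
  have hge := card_subsetSums_ge hR
  have haK := Multiset.count_le_card a R
  by_cases h : 2 * (n - R.card) ≤ R.card
  · have := card_subsetSums_of_pairs (n - R.card) R hR h fun c => by have := ha c; omega
    omega
  · obtain ⟨s, hs | hs⟩ := Nat.even_or_odd' R.card
    · have := card_subsetSums_of_pairs s R hR (by omega) fun c => by have := ha c; omega
      omega
    · have := card_subsetSums_of_odd hR hs fun c => by have := ha c; omega
      omega

set_option synthInstance.maxSize 2000 in
theorem ZeroSumFree.exists_unit_of_four {R : Multiset (ZMod 4)} (hR : ZeroSumFree R)
    (hc : R.card = 2) :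
    ∃ g : (ZMod 4)ˣ, ((R.map fun x => (g : ZMod 4) * x).map ZMod.val).sum < 4 := by
  have key : ∀ a b : ZMod 4, a ≠ 0 → b ≠ 0 → a + b ≠ 0 → ∃ g g' : ZMod 4,
      g * g' = 1 ∧ (g * a).val + (g * b).val < 4 := by decide +kernel
  obtain ⟨a, b, rfl⟩ := Multiset.card_eq_two.1 hc
  obtain ⟨g, g', h1, h2⟩ := key a b
    (fun h => hR.zero_notMem (by simp [h])) (fun h => hR.zero_notMem (by simp [h]))
    (by simpa using hR.sum_ne_zero le_rfl (by simp))
  exact ⟨Units.mkOfMulEqOne g g' h1, by simpa using h2⟩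

set_option synthInstance.maxSize 2000 in
theorem ZeroSumFree.exists_unit_of_seven {R : Multiset (ZMod 7)} (hR : ZeroSumFree R)
    (hc : R.card = 4) :
    ∃ g : (ZMod 7)ˣ, ((R.map fun x => (g : ZMod 7) * x).map ZMod.val).sum < 7 := by
  have key : ∀ a b c d : ZMod 7, a ≠ 0 → b ≠ 0 → c ≠ 0 → d ≠ 0 → a + b ≠ 0 → a + c ≠ 0 →
      a + d ≠ 0 → b + c ≠ 0 → b + d ≠ 0 → c + d ≠ 0 → a + b + c ≠ 0 → a + b + d ≠ 0 →
      a + c + d ≠ 0 → b + c + d ≠ 0 → a + b + c + d ≠ 0 → ∃ g g' : ZMod 7,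
      g * g' = 1 ∧ (g * a).val + (g * b).val + (g * c).val + (g * d).val < 7 := by
    decide +kernel
  obtain ⟨a, ha⟩ := Multiset.exists_mem_of_ne_zero (s := R) (by rintro rfl; simp at hc)
  obtain ⟨R', rfl⟩ := Multiset.exists_cons_of_mem ha
  obtain ⟨b, c, d, rfl⟩ := Multiset.card_eq_three.1 (by simpa using hc : R'.card = 3)
  have hsub : ∀ U : Multiset (ZMod 7), U ∈ Multiset.powerset (a ::ₘ {b, c, d}) → U ≠ 0 →
      U.sum ≠ 0 := fun U hU hne => hR.sum_ne_zero (Multiset.mem_powerset.1 hU) hne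
  obtain ⟨g, g', h1, h2⟩ := key a b c d (by simpa using hsub {a})
    (by simpa using hsub {b}) (by simpa using hsub {c}) (by simpa using hsub {d})
    (by simpa using hsub {a, b}) (by simpa using hsub {a, c}) (by simpa using hsub {a, d})
    (by simpa using hsub {b, c}) (by simpa using hsub {b, d}) (by simpa using hsub {c, d})
    (by simpa [add_assoc] using hsub {a, b, c}) (by simpa [add_assoc] using hsub {a, b, d})
    (by simpa [add_assoc] using hsub {a, c, d}) (by simpa [add_assoc] using hsub {b, c, d})
    (by simpa [add_assoc] using hsub {a, b, c, d})
  exact ⟨Units.mkOfMulEqOne g g' h1, by simpa [add_assoc] using h2⟩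

/-- The most frequent term of a long zero-sum free sequence in `ZMod n` generates. -/
theorem ZeroSumFree.zmultiples_eq_top [NeZero n] {R : Multiset (ZMod n)} (hR : ZeroSumFree R)
    (hK : 3 * n ≤ 4 * R.card + 5) (hex : ¬(n = 4 ∧ R.card = 2)) {a : ZMod n} (ha : a ∈ R)
    (hM : 2 * R.card + 1 ≤ R.count a + n) : AddSubgroup.zmultiples a = ⊤ := by
  have hrep : ∀ j ≤ R.count a, Multiset.replicate j a ≤ R := fun j hj =>
    Multiset.le_count_iff_replicate_le.1 hj
  have ha0 : a ≠ 0 := fun h => hR.zero_notMem (h ▸ ha)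
  have hMd : R.count a < addOrderOf a := by
    by_contra! h
    refine hR.sum_ne_zero (hrep _ h) ?_ (by rw [Multiset.sum_replicate, addOrderOf_nsmul_eq_zero])
    rw [← Multiset.card_pos, Multiset.card_replicate]
    exact addOrderOf_pos a
  have hd1 : addOrderOf a ≠ 1 := by simpa using ha0
  have hidx : (AddSubgroup.zmultiples a).index * addOrderOf a = n := by
    rw [← Nat.card_zmultiples, AddSubgroup.index_mul_card, Nat.card_zmod]
  have hnpos : 0 < n := NeZero.pos n
  rw [← AddSubgroup.index_eq_one]
  set q := (AddSubgroup.zmultiples a).index with hq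
  set d := addOrderOf a with hd
  by_contra hq1
  have hq0 : q ≠ 0 := by rintro h; simp [h] at hidx; omega
  have hq2 : q = 2 := by
    by_contra h
    have : 3 * d ≤ q * d := Nat.mul_le_mul_right _ (by omega)
    omega
  rw [hq2] at hidx
  have hMd' : R.count a + 1 = d := by omega
  have hout : ∀ U : Multiset (ZMod n), Multiset.replicate (R.count a) a + U ≤ R → U ≠ 0 →
      U.sum ∉ AddSubgroup.zmultiples a := by
    intro U hU hne hmem
    have hmem' := neg_mem hmem
    obtain ⟨j, hj, hj'⟩ : ∃ j < d, j • a = -U.sum := by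
      have := mem_zmultiples_iff_mem_range_addOrderOf.1 hmem'
      simpa using this
    refine hR.sum_ne_zero (U := Multiset.replicate j a + U)
      (le_trans (add_le_add ((Multiset.replicate_le_replicate _).2 (by omega)) le_rfl) hU)
      (fun h => hne (add_eq_zero.1 h).2) (by simp [hj'])
  obtain ⟨Y, hY⟩ := Multiset.le_iff_exists_add.1 (hrep _ le_rfl)
  have hYc : R.card = R.count a + Y.card := by
    conv_lhs => rw [hY]
    simp
  have hY2 : 2 ≤ Y.card := by
    by_contra! h
    exact hex ⟨by omega, by omega⟩
  obtain ⟨U, hU'⟩ := Multiset.exists_mem_of_ne_zero (s := Multiset.powersetCard 2 Y) (by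
    rw [← Multiset.card_pos, Multiset.card_powersetCard]
    exact Nat.choose_pos hY2)
  obtain ⟨hU, hc⟩ := Multiset.mem_powersetCard.1 hU'
  obtain ⟨r, r', rfl⟩ := Multiset.card_eq_two.1 hc
  have hle : ∀ U ≤ Y, Multiset.replicate (R.count a) a + U ≤ R := fun U hU => by
    conv_rhs => rw [hY]
    exact add_le_add le_rfl hU
  have h1 := hout {r} (hle _ (le_trans (by simp) hU)) (by simp)
  have h2 := hout {r'} (hle _ (le_trans (by simp) hU)) (by simp)
  have h3 := hout {r, r'} (hle _ hU) (by simp)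
  simp only [Multiset.sum_singleton, Multiset.sum_pair] at h1 h2 h3
  exact h3 ((AddSubgroup.add_mem_iff_of_index_two (hq.symm.trans hq2)).2 (by tauto))

/-- A long zero-sum free sequence in `ZMod n` becomes, after multiplication by a unit, one whose
least positive representatives have sum less than `n`. -/
theorem ZeroSumFree.exists_unit_sum_val_lt [NeZero n] {R : Multiset (ZMod n)}
    (hR : ZeroSumFree R) (hK : 3 * n ≤ 4 * R.card + 5) :
    ∃ g : (ZMod n)ˣ, ((R.map fun x => (g : ZMod n) * x).map ZMod.val).sum < n := by
  by_cases hne : R = 0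
  · exact ⟨1, by simpa [hne] using NeZero.pos n⟩
  by_cases h4 : n = 4 ∧ R.card = 2
  · obtain ⟨rfl, hc⟩ := h4
    exact hR.exists_unit_of_four hc
  by_cases h7 : n = 7 ∧ R.card = 4
  · obtain ⟨rfl, hc⟩ := h7
    exact hR.exists_unit_of_seven hc
  obtain ⟨a, ha, hmax⟩ := exists_count_max hne
  have hM := hR.count_max_ge hK h7 hne hmax (Multiset.one_le_count_iff_mem.2 ha)
  have htop := hR.zmultiples_eq_top hK h4 ha hM
  have h1mem : (1 : ZMod n) ∈ AddSubgroup.zmultiples a := htop ▸ AddSubgroup.mem_top _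
  obtain ⟨z, hz⟩ := AddSubgroup.mem_zmultiples_iff.1 h1mem
  have hza : (z : ZMod n) * a = 1 := by simpa using hz
  let g : (ZMod n)ˣ := Units.mkOfMulEqOne (z : ZMod n) a hza
  have hn1 : 1 < n := by
    have := NeZero.pos n
    by_contra! h
    obtain rfl : n = 1 := by omega
    exact hR.zero_notMem (Subsingleton.elim a 0 ▸ ha)
  refine ⟨g, ?_⟩
  have hmul : (R.map fun x => (g : ZMod n) * x) =
      R.map (DistribMulAction.toAddEquiv (ZMod n) g) :=
    Multiset.map_congr rfl fun x _ => rfl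
  rw [hmul]
  refine ZeroSumFree.sum_val_lt_of_count_one hn1 (hR.map _) ?_ (by simpa using hK)
    (by simpa using h7)
  have hc : (R.map (DistribMulAction.toAddEquiv (ZMod n) g)).count 1 = R.count a := by
    have h1 : (1 : ZMod n) = DistribMulAction.toAddEquiv (ZMod n) g a := hza.symm
    rw [h1, Multiset.count_map_eq_count' _ _ (AddEquiv.injective _)]
  rw [hc, Multiset.card_map]
  exact hM

end Structure

section Main

variable {n : ℕ}

theorem card_le_mul_of_notMem {α : Type*} [Fintype α] [DecidableEq α] {T : Multiset α} {x : α}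
    {h : ℕ} (hx : x ∉ T) (hT : ∀ z, T.count z ≤ h) : T.card ≤ (Fintype.card α - 1) * h := by
  rw [← Multiset.toFinset_sum_count_eq T]
  refine (Finset.sum_le_card_nsmul _ _ h fun z _ => hT z).trans (Nat.mul_le_mul_right _ ?_)
  rw [← Finset.card_univ, ← Finset.card_erase_of_mem (Finset.mem_univ x)]
  exact Finset.card_le_card fun z hz => Finset.mem_erase.2
    ⟨fun h => hx (h ▸ Multiset.mem_toFinset.1 hz), Finset.mem_univ z⟩

/-- If `T` together with `h` zeros has no zero-sum subsequence of length `n`, then zero-sum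
subsequences of `T` are short. -/
theorem card_add_lt_of_sum_eq_zero [NeZero n] {T : Multiset (ZMod n)} {h : ℕ} (h0 : 0 ∉ T)
    (hcount : ∀ z, T.count z ≤ h)
    (hzs : ∀ U ≤ T, ∀ j ≤ h, U.card + j = n → U.sum ≠ 0) (Z : Multiset (ZMod n)) :
    Z ≤ T → Z.sum = 0 → Z.card + h < n := by
  induction Z using Multiset.strongInductionOn with
  | ih Z ih =>
  intro hZ hs
  by_contra! hle
  rcases le_or_gt Z.card n with hc | hc
  · exact hzs Z hZ (n - Z.card) (by omega) (by omega) hs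
  · obtain ⟨U, hU, hUc, hUs, hU0⟩ := exists_short_zero_sum h Z
      (fun z => (Multiset.count_le_of_le z hZ).trans (hcount z))
      (fun hm => h0 (Multiset.mem_of_le hZ hm)) (by rw [ZMod.card]; omega)
    obtain ⟨V, rfl⟩ := Multiset.le_iff_exists_add.1 hU
    have hUpos := Multiset.card_pos.2 hU0
    rw [Multiset.card_add] at hc
    have := ih V (lt_of_le_of_ne (Multiset.le_add_left _ _) fun h => by
        have := congrArg Multiset.card h
        rw [Multiset.card_add] at this
        omega) ((Multiset.le_add_left _ _).trans hZ)
      (by rwa [Multiset.sum_add, hUs, zero_add] at hs)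
    omega

theorem ZMod.natCast_sum_map_sub_val [NeZero n] (U : Multiset (ZMod n)) :
    (((U.map fun w => n - w.val).sum : ℕ) : ZMod n) = -U.sum := by
  rw [Nat.cast_multiset_sum, Multiset.map_map, ← Multiset.sum_map_neg']
  refine congrArg _ (Multiset.map_congr rfl fun w _ => ?_)
  simp [Nat.cast_sub (ZMod.val_lt w).le]

section Decomposition

variable {k h : ℕ} {R W : Multiset (ZMod n)}

/-- The terms of `W` with small representatives contribute, together with `R`, less than `n`. -/
theorem sum_val_add_sum_val_lt [NeZero n] (h0 : 0 ∉ R)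
    (hZ : ∀ Z ≤ R + W, Z.sum = 0 → Z.card + h < n)
    (hK : 3 * n ≤ 4 * R.card + 5) (hL : (R.map ZMod.val).sum < n)
    (hμ : (R.map ZMod.val).sum < 2 * R.card) (hh : 2 * R.card ≤ (R.map ZMod.val).sum + h)
    {P : Multiset (ZMod n)} (hP : P ≤ W) (hPL : ∀ w ∈ P, w.val + (R.map ZMod.val).sum < n) :
    (R.map ZMod.val).sum + (P.map ZMod.val).sum < n := by
  have hR1 : ∀ r ∈ R, 1 ≤ r.val := fun r hr => ZMod.one_le_val fun h => h0 (h ▸ hr)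
  have hKL := card_le_sum_map ZMod.val hR1
  set L := (R.map ZMod.val).sum with hLdef
  by_contra! hge
  obtain ⟨Q, w, hQ, h1, h2⟩ := exists_crossing ZMod.val (c := n - L) (by omega) P (by omega)
  have hw := hPL w (Multiset.mem_of_le hQ (Multiset.mem_cons_self _ _))
  obtain ⟨V, hV, hVs, -⟩ := exists_le_sum_map_eq ZMod.val R hR1 hμ
    (L + (Q.map ZMod.val).sum + w.val - n) (by omega)
  have hVc := card_le_sum_map ZMod.val fun r hr => hR1 r (Multiset.mem_of_le hV hr)
  obtain ⟨X, rfl⟩ := Multiset.le_iff_exists_add.1 hV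
  simp only [Multiset.map_add, Multiset.sum_add, Multiset.card_add] at hLdef hK hh hμ hKL
  have := hZ (X + w ::ₘ Q) (add_le_add (Multiset.le_add_left _ _) (hQ.trans hP)) (by
    rw [← ZMod.natCast_sum_map_val, ZMod.natCast_eq_zero_iff]
    refine ⟨1, ?_⟩
    simp only [Multiset.map_add, Multiset.sum_add, Multiset.map_cons, Multiset.sum_cons]
    omega)
  simp only [Multiset.card_add, Multiset.card_cons] at this
  omega

/-- The terms of `W` with large representatives are few. -/
theorem add_sum_sub_val_lt [NeZero n] (h0 : 0 ∉ R)
    (hZ : ∀ Z ≤ R + W, Z.sum = 0 → Z.card + h < n)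
    (hK : 3 * n ≤ 4 * R.card + 5) (hL : (R.map ZMod.val).sum < n)
    (hμ : (R.map ZMod.val).sum < 2 * R.card) (hh : 2 * R.card ≤ (R.map ZMod.val).sum + h)
    (hedge : n + (R.map ZMod.val).sum ≤ h + 2 * R.card + 1)
    {N : Multiset (ZMod n)} (hN : N ≤ W) (hNL : ∀ w ∈ N, n ≤ w.val + (R.map ZMod.val).sum) :
    h + (N.map fun w => n - w.val + 1).sum < n := by
  have hR1 : ∀ r ∈ R, 1 ≤ r.val := fun r hr => ZMod.one_le_val fun h => h0 (h ▸ hr)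
  set L := (R.map ZMod.val).sum with hLdef
  have hhn : h < n := by simpa using hZ 0 zero_le (by simp)
  have key : ∀ Q ≤ N, (Q.map fun w => n - w.val).sum ≤ L →
      Q.card + min (Q.map fun w => n - w.val).sum (2 * R.card - L) + h < n := by
    intro Q hQ hle
    obtain ⟨U, hU, hUs, hUc⟩ := exists_le_sum_map_eq ZMod.val R hR1 hμ _ hle
    have := hZ (U + Q) (add_le_add hU (hQ.trans hN)) (by
      rw [Multiset.sum_add, ← ZMod.natCast_sum_map_val U, hUs, ZMod.natCast_sum_map_sub_val]
      simp)
    rw [Multiset.card_add] at this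
    omega
  have hsingle : ∀ w ∈ N, n - w.val + 1 + h < n := by
    intro w hw
    have h1 := hNL w hw
    have h2 := key {w} (by simpa using hw) (by simp; omega)
    simp at h2
    omega
  by_contra! hge
  obtain ⟨Q, w, hQ, h1, h2⟩ := exists_crossing (fun w : ZMod n => n - w.val + 1) (c := n - h)
    (by omega) N (by omega)
  have hw := hsingle w (Multiset.mem_of_le hQ (Multiset.mem_cons_self _ _))
  have hsum : (Q.map fun w => n - w.val + 1).sum = (Q.map fun w => n - w.val).sum + Q.card := by
    rw [Multiset.sum_map_add]
    simp
  have hQ0 : 1 ≤ Q.card := by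
    by_contra! hc
    obtain rfl : Q = 0 := Multiset.card_eq_zero.1 (by omega)
    simp at h2
    omega
  have := key _ hQ (by simp only [Multiset.map_cons, Multiset.sum_cons]; omega)
  simp only [Multiset.map_cons, Multiset.sum_cons, Multiset.card_cons] at this
  omega

/-- The degenerate range of parameters does not occur. -/
theorem le_add_of_decomposition [NeZero n] (hn : 2 ≤ n) (hk : k ≤ (n + 1) / 4 + 2)
    (hex : ¬(n = 3 ∧ k = 3)) (h0 : 0 ∉ R + W) (hcard : (R + W).card + h + k = 2 * n)
    (hcount : ∀ z, (R + W).count z ≤ h) (hZ : ∀ Z ≤ R + W, Z.sum = 0 → Z.card + h < n)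
    (hW : W.sum = 0) (hL : (R.map ZMod.val).sum < n)
    (hμ : (R.map ZMod.val).sum < 2 * R.card) (hh : 2 * R.card ≤ (R.map ZMod.val).sum + h) :
    n + (R.map ZMod.val).sum ≤ h + 2 * R.card + 1 := by
  have hR1 : ∀ r ∈ R, 1 ≤ r.val := fun r hr =>
    ZMod.one_le_val fun h => h0 (h ▸ Multiset.mem_add.2 (Or.inl hr))
  have hWc := hZ W (Multiset.le_add_left _ _) hW
  have hT := card_le_mul_of_notMem h0 hcount
  rw [ZMod.card] at hT
  rw [Multiset.card_add] at hcard hT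
  by_contra! hlt
  obtain ⟨w, hw⟩ := Multiset.exists_mem_of_ne_zero (s := W) (by
    rw [← Multiset.card_pos]
    omega)
  have hw1 : 1 ≤ w.val := ZMod.one_le_val fun h => h0 (h ▸ Multiset.mem_add.2 (Or.inr hw))
  have hwn := ZMod.val_lt w
  obtain ⟨W', rfl⟩ := Multiset.exists_cons_of_mem hw
  obtain ⟨U, hU, hUs, hUc⟩ := exists_le_sum_map_eq ZMod.val R hR1 hμ w.val (by omega)
  have h1 := hZ (U + W') (add_le_add hU (Multiset.le_cons_self _ _)) (by
    rw [Multiset.sum_add, ← ZMod.natCast_sum_map_val U, hUs]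
    simpa using hW)
  rw [Multiset.card_add] at h1
  rw [Multiset.card_cons] at *
  by_cases hμ2 : (R.map ZMod.val).sum + 2 ≤ 2 * R.card
  · have h2 := hZ (R + {w}) (add_le_add le_rfl (by simp)) (by
      rw [← ZMod.natCast_sum_map_val, ZMod.natCast_eq_zero_iff]
      refine ⟨1, ?_⟩
      simp only [Multiset.map_add, Multiset.sum_add, Multiset.map_singleton,
        Multiset.sum_singleton]
      omega)
    rw [Multiset.card_add, Multiset.card_singleton] at h2
    omega
  · obtain rfl : n = 4 := by omega
    omega

theorem le_add_count_one [NeZero n] (hn : 2 ≤ n) (hk : k ≤ (n + 1) / 4 + 2)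
    (hex : ¬(n = 3 ∧ k = 3)) (h0 : 0 ∉ R + W) (hcard : (R + W).card + h + k = 2 * n)
    (hcount : ∀ z, (R + W).count z ≤ h) (hZ : ∀ Z ≤ R + W, Z.sum = 0 → Z.card + h < n)
    (hW : W.sum = 0) (hL : (R.map ZMod.val).sum < n) :
    2 * n + 2 ≤ 2 * k + h + (R + W).count 1 := by
  have : Fact (1 < n) := ⟨hn⟩
  have h1 : ∀ X ≤ R + W, ∀ r ∈ X, 1 ≤ r.val := fun X hX r hr =>
    ZMod.one_le_val fun h => h0 (h ▸ Multiset.mem_of_le hX hr)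
  have hcnt : ∀ X ≤ R + W, 2 * X.card ≤ (X.map ZMod.val).sum + (R + W).count 1 := by
    intro X hX
    refine (two_mul_card_le ZMod.val (h1 X hX)).trans (Nat.add_le_add_left ?_ _)
    refine (Multiset.countP_le_of_le _ hX).trans (le_of_eq (Multiset.countP_congr rfl ?_))
    intro x _
    refine propext ⟨fun h => ?_, fun h => ?_⟩
    · exact ZMod.val_injective n (by rw [h, ZMod.val_one])
    · rw [← h, ZMod.val_one]
  have hR0 : 0 ∉ R := fun h => h0 (Multiset.mem_add.2 (Or.inl h))
  have hWc := hZ W (Multiset.le_add_left _ _) hW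
  have hcard' := hcard
  rw [Multiset.card_add] at hcard'
  have hRcnt := hcnt R (Multiset.le_add_right _ _)
  have hh := hcount 1
  have hμ : (R.map ZMod.val).sum < 2 * R.card := by omega
  have hedge := le_add_of_decomposition hn hk hex h0 hcard hcount hZ hW hL hμ (by omega)
  have hsplit := Multiset.filter_add_not (fun w => w.val + (R.map ZMod.val).sum < n) W
  set P := W.filter (fun w => w.val + (R.map ZMod.val).sum < n) with hPdef
  set N := W.filter (fun w => ¬ w.val + (R.map ZMod.val).sum < n) with hNdef
  have hPW : P ≤ W := Multiset.filter_le _ _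
  have hP := sum_val_add_sum_val_lt hR0 hZ (by omega) hL hμ (by omega) hPW
    fun w hw => (Multiset.mem_filter.1 hw).2
  have hN := add_sum_sub_val_lt (N := N) hR0 hZ (by omega) hL hμ (by omega) hedge
    (Multiset.filter_le _ _) fun w hw => not_lt.1 (Multiset.mem_filter.1 hw).2
  have hN2 : N.card * 2 ≤ (N.map fun w => n - w.val + 1).sum := by
    simpa using Multiset.sum_map_le_sum_map (s := N) (fun _ => 2) (fun w => n - w.val + 1)
      fun w _ => by have := ZMod.val_lt w; omega
  have hRP := hcnt (R + P) (add_le_add le_rfl hPW)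
  rw [Multiset.map_add, Multiset.sum_add, Multiset.card_add] at hRP
  have hWcard := congrArg Multiset.card hsplit
  rw [Multiset.card_add] at hWcard
  omega

end Decomposition

theorem exists_unit_le_add_count [NeZero n] {k h : ℕ} {T : Multiset (ZMod n)} (hn : 2 ≤ n)
    (hk : k ≤ (n + 1) / 4 + 2) (hex : ¬(n = 3 ∧ k = 3)) (h0 : 0 ∉ T)
    (hcard : T.card + h + k = 2 * n) (hcount : ∀ z, T.count z ≤ h)
    (hZ : ∀ Z ≤ T, Z.sum = 0 → Z.card + h < n) :
    ∃ g : (ZMod n)ˣ, 2 * n + 2 ≤ 2 * k + h + T.count (g : ZMod n) := by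
  obtain ⟨W, hW, hmax⟩ := Finset.exists_max_image
    (T.powerset.toFinset.filter fun W => W.sum = 0) Multiset.card ⟨0, by simp⟩
  simp only [Finset.mem_filter, Multiset.mem_toFinset, Multiset.mem_powerset] at hW hmax
  obtain ⟨R, rfl⟩ := Multiset.le_iff_exists_add.1 hW.1
  rw [add_comm W R] at *
  have hR : ZeroSumFree R := by
    intro U hU hs
    have := hmax (U + W) ⟨add_le_add hU le_rfl, by rw [Multiset.sum_add, hs, hW.2, add_zero]⟩
    rw [Multiset.card_add] at this
    exact Multiset.card_eq_zero.1 (by omega)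
  have hWc := hZ W hW.1 hW.2
  have hcard' := hcard
  rw [Multiset.card_add] at hcard'
  obtain ⟨g, hg⟩ := hR.exists_unit_sum_val_lt (by omega)
  let e : ZMod n ≃+ ZMod n := DistribMulAction.toAddEquiv (ZMod n) g
  have hcnt : ∀ z, (R.map e + W.map e).count z = (R + W).count (e.symm z) := fun z => by
    conv_lhs => rw [← e.apply_symm_apply z]
    rw [← Multiset.map_add, Multiset.count_map_eq_count' _ _ e.injective]
  have := le_add_count_one (h := h) (R := R.map e) (W := W.map e) hn hk hex
    (by
      rw [← Multiset.map_add]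
      intro hm
      obtain ⟨x, hx, hx0⟩ := Multiset.mem_map.1 hm
      exact h0 ((map_eq_zero_iff e e.injective).1 hx0 ▸ hx))
    (by rwa [← Multiset.map_add, Multiset.card_map])
    (fun z => (hcnt z).trans_le (hcount _))
    (fun Z hZle hZs => by
      have := hZ (Z.map e.symm)
        (by simpa [Multiset.map_map] using Multiset.map_le_map (f := e.symm) hZle)
        (by rw [← map_multiset_sum, hZs, map_zero])
      rwa [Multiset.card_map] at this)
    (by rw [← map_multiset_sum, hW.2, map_zero]) hg
  refine ⟨g⁻¹, ?_⟩
  have he : e.symm 1 = ((g⁻¹ : (ZMod n)ˣ) : ZMod n) := by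
    rw [AddEquiv.symm_apply_eq]
    exact (Units.mul_inv g).symm
  rwa [hcnt, he] at this

theorem zmultiples_eq_top_of_isUnit {a : ZMod n} (ha : IsUnit a) :
    AddSubgroup.zmultiples a = ⊤ := by
  obtain ⟨b, hb⟩ := ha.exists_left_inv
  obtain ⟨z, rfl⟩ := ZMod.intCast_surjective b
  rw [AddSubgroup.eq_top_iff']
  intro x
  obtain ⟨y, rfl⟩ := ZMod.intCast_surjective x
  refine AddSubgroup.mem_zmultiples_iff.2 ⟨y * z, ?_⟩
  rw [zsmul_eq_mul, Int.cast_mul, mul_assoc, hb, mul_one]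

theorem exists_unit_le_count_add_count [NeZero n] {k : ℕ} {S : Multiset (ZMod n)} (hn : 2 ≤ n)
    (hk : k ≤ (n + 1) / 4 + 2) (hex : ¬(n = 3 ∧ k = 3)) (hcard : S.card = 2 * n - k)
    (hzs : ¬ ∃ T ≤ S, Multiset.card T = n ∧ T.sum = 0) :
    ∃ (a : ZMod n) (g : (ZMod n)ˣ), (∀ c, S.count c ≤ S.count a) ∧
      2 * n + 2 ≤ 2 * k + S.count a + S.count (g + a) := by
  obtain ⟨a, -, ha⟩ := exists_count_max (R := S) (by
    rw [← Multiset.card_pos]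
    omega)
  set X := S.filter (fun x => ¬ a = x) with hX
  have hSX : S = X + Multiset.replicate (S.count a) a := by
    rw [← Multiset.filter_eq, add_comm]
    exact (Multiset.filter_add_not _ _).symm
  let e : ZMod n ≃ ZMod n := Equiv.addRight a
  have hcX : ∀ z, (X.map e.symm).count z ≤ S.count (z + a) := fun z => by
    have h1 : (X.map e.symm).count z = X.count (z + a) := by
      conv_lhs => rw [← e.symm_apply_apply z]
      exact Multiset.count_map_eq_count' _ _ e.symm.injective _
    rw [h1]
    exact Multiset.count_le_of_le _ (Multiset.filter_le _ _)
  have h0 : 0 ∉ X.map e.symm := by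
    intro h
    obtain ⟨x, hx, hx0⟩ := Multiset.mem_map.1 h
    rw [Equiv.symm_apply_eq] at hx0
    exact (Multiset.mem_filter.1 hx).2 (by simpa [e] using hx0.symm)
  have hc : S.card = X.card + S.count a := by
    conv_lhs => rw [hSX]
    simp
  obtain ⟨g, hg⟩ := exists_unit_le_add_count (h := S.count a) hn hk hex h0
    (by rw [Multiset.card_map]; omega) (fun z => (hcX z).trans (ha _))
    (card_add_lt_of_sum_eq_zero h0 (fun z => (hcX z).trans (ha _)) (by
      intro U hU j hj hUj hUs
      refine hzs ⟨U.map e + Multiset.replicate j a, ?_, by simpa using hUj, ?_⟩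
      · conv_rhs => rw [hSX]
        refine add_le_add ?_ ((Multiset.replicate_le_replicate _).2 hj)
        simpa [Multiset.map_map] using Multiset.map_le_map (f := e) hU
      · have : (U.map e).sum = U.sum + U.card • a := by
          simp [e, Multiset.sum_map_add]
        rw [Multiset.sum_add, this, hUs, Multiset.sum_replicate, zero_add, ← add_nsmul, hUj]
        simp))
  exact ⟨a, g, ha, hg.trans (Nat.add_le_add_left (hcX _) _)⟩

end Main


/-- Gao's theorem: let `n` be positive, `2 ≤ k ≤ ⌊(n+1)/4⌋ + 2`, and `S` a sequence in
`ZMod n` of length `2n - k` with no zero-sum subsequence of length `n`. Then there are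
`a, b ∈ ZMod n` with `a - b` generating `ZMod n`, and `u ≥ v` with `u + v ≥ 2n - 2k + 2`,
such that `a` occurs at least `u` times and `b` at least `v` times in `S`. -/
theorem stmt_9 (n k : ℕ) (hn : 0 < n) (hk2 : 2 ≤ k) (hk : k ≤ (n + 1) / 4 + 2)
    (S : Multiset (ZMod n)) (hcard : Multiset.card S = 2 * n - k)
    (hzs : ¬ ∃ T ≤ S, Multiset.card T = n ∧ T.sum = 0) :
    ∃ (a b : ZMod n) (u v : ℕ),
      AddSubgroup.zmultiples (a - b) = ⊤ ∧ v ≤ u ∧ 2 * n + 2 - 2 * k ≤ u + v ∧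
      u ≤ S.count a ∧ v ≤ S.count b := by
  have : NeZero n := ⟨hn.ne'⟩
  obtain rfl | hn2 : n = 1 ∨ 2 ≤ n := by omega
  · exact ⟨0, 0, 0, 0, Subsingleton.elim _ _, le_rfl, by omega, zero_le, zero_le⟩
  by_cases hex : n = 3 ∧ k = 3
  · obtain ⟨rfl, rfl⟩ := hex
    obtain ⟨x, y, z, rfl⟩ := Multiset.card_eq_three.1 hcard
    have key : ∀ x y z : ZMod 3, x + (y + z) ≠ 0 → IsUnit (x - y) ∨ IsUnit (x - z) := by
      decide
    have hpair : ∀ b ∈ ({x, y, z} : Multiset (ZMod 3)), IsUnit (x - b) →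
        ∃ (a b : ZMod 3) (u v : ℕ), AddSubgroup.zmultiples (a - b) = ⊤ ∧ v ≤ u ∧
          2 * 3 + 2 - 2 * 3 ≤ u + v ∧ u ≤ Multiset.count a {x, y, z} ∧
          v ≤ Multiset.count b {x, y, z} := fun b hb h =>
      ⟨x, b, 1, 1, zmultiples_eq_top_of_isUnit h, le_rfl, by norm_num,
        Multiset.one_le_count_iff_mem.2 (Multiset.mem_cons_self _ _),
        Multiset.one_le_count_iff_mem.2 hb⟩
    rcases key x y z (fun h => hzs ⟨_, le_rfl, rfl, by simpa using h⟩) with h | h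
    · exact hpair y (by simp) h
    · exact hpair z (by simp) h
  · obtain ⟨a, g, ha, hg⟩ := exists_unit_le_count_add_count hn2 hk hex hcard hzs
    refine ⟨a, g + a, S.count a, S.count (g + a), zmultiples_eq_top_of_isUnit ?_, ha _, by omega,
      le_rfl, le_rfl⟩
    simp
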